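/- Assume that for every n ≥ 1 the left R-module M_n = R/R·a^n is uniserial of length n. Then the a-Prüfer module U_{R,a} is a uniserial and artinian left R-module, and it is not noetherian. -/

import Mathlib

/-- The transition map `ψ_{i,ℓ} : R/Ra^i → R/Ra^ℓ`, `r + Ra^i ↦ r·a^{ℓ-i} + Ra^ℓ`. -/
def psi {R : Type*} [Ring R] (a : R) (i ℓ : ℕ) (h : i ≤ ℓ) :
    (R ⧸ Submodule.span R {a ^ i}) →ₗ[R] (R ⧸ Submodule.span R {a ^ ℓ}) :=
  Submodule.liftQ _
    ((Submodule.span R {a ^ ℓ}).mkQ ∘ₗ LinearMap.toSpanSingleton R R (a ^ (ℓ - i)))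
    (by
      rw [Submodule.span_le]
      rintro x hx
      rw [Set.mem_singleton_iff] at hx
      subst hx
      simp only [SetLike.mem_coe, LinearMap.mem_ker, LinearMap.comp_apply,
        LinearMap.toSpanSingleton_apply, Submodule.mkQ_apply,
        Submodule.Quotient.mk_eq_zero, smul_eq_mul]
      rw [← pow_add, Nat.add_sub_cancel' h]
      exact Submodule.mem_span_singleton_self _)

/-- The `a`-Prüfer module `U_{R,a}`: the direct limit of the system `{M_i, ψ_{i,j}}_{1 ≤ i ≤ j}`,
realized as the direct limit over `n : ℕ` of `M_{n+1} = R/R·a^{n+1}`. -/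
noncomputable abbrev pruefer (R : Type*) [Ring R] (a : R) : Type _ :=
  Module.DirectLimit (fun n : ℕ => R ⧸ Submodule.span R {a ^ (n + 1)})
    (fun i j h => psi a (i + 1) (j + 1) (Nat.succ_le_succ h))

theorem psi_mk {R : Type*} [Ring R] (a : R) (i l : ℕ) (h : i ≤ l) (r : R) :
    psi a i l h (Submodule.Quotient.mk r) = Submodule.Quotient.mk (r * a ^ (l - i)) := rfl

theorem psi_inj {R : Type*} [Ring R] (a : R) (h1 : ∀ r : R, r * a = 0 → r = 0)
    (i l : ℕ) (h : i ≤ l) : Function.Injective (psi a i l h) := by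
  have hp : ∀ (k : ℕ) (r : R), r * a ^ k = 0 → r = 0 := by
    intro k
    induction k with
    | zero => intro r hr; simpa using hr
    | succ k ih =>
      intro r hr
      rw [pow_succ, ← mul_assoc] at hr
      exact ih _ (h1 _ hr)
  rw [injective_iff_map_eq_zero]
  intro x hx
  obtain ⟨r, rfl⟩ := Submodule.Quotient.mk_surjective _ x
  rw [psi_mk, Submodule.Quotient.mk_eq_zero, Submodule.mem_span_singleton] at hx
  obtain ⟨s, hs⟩ := hx
  rw [Submodule.Quotient.mk_eq_zero, Submodule.mem_span_singleton]
  refine ⟨s, ?_⟩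
  have : (s * a ^ i - r) * a ^ (l - i) = 0 := by
    rw [sub_mul, mul_assoc, ← pow_add, Nat.add_sub_cancel' h, sub_eq_zero]
    exact hs
  exact sub_eq_zero.mp (hp _ _ this)

instance psi_directed {R : Type*} [Ring R] (a : R) :
    DirectedSystem (fun n : ℕ => R ⧸ Submodule.span R {a ^ (n + 1)})
    (fun i j h => psi a (i + 1) (j + 1) (Nat.succ_le_succ h)) where
  map_self i x := by
    obtain ⟨r, rfl⟩ := Submodule.Quotient.mk_surjective _ x
    rw [psi_mk]; simp
  map_map k j i hij hjk x := by
    obtain ⟨r, rfl⟩ := Submodule.Quotient.mk_surjective _ x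
    rw [psi_mk, psi_mk, psi_mk, mul_assoc, ← pow_add]
    congr 3
    omega

/-- canonical map -/
noncomputable def pOf {R : Type*} [Ring R] (a : R) (n : ℕ) :
    (R ⧸ Submodule.span R {a ^ (n + 1)}) →ₗ[R] pruefer R a :=
  Module.DirectLimit.of R ℕ (fun n : ℕ => R ⧸ Submodule.span R {a ^ (n + 1)})
    (fun i j h => psi a (i + 1) (j + 1) (Nat.succ_le_succ h)) n

theorem pOf_psi {R : Type*} [Ring R] (a : R) (i j : ℕ) (h : i + 1 ≤ j + 1)
    (x : R ⧸ Submodule.span R {a ^ (i + 1)}) :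
    pOf a j (psi a (i + 1) (j + 1) h x) = pOf a i x :=
  Module.DirectLimit.of_f (G := fun n : ℕ => R ⧸ Submodule.span R {a ^ (n + 1)})
    (f := fun i j h => psi a (i + 1) (j + 1) (Nat.succ_le_succ h))
    (hij := Nat.le_of_succ_le_succ h)

theorem pOf_inj {R : Type*} [Ring R] (a : R) (h1 : ∀ r : R, r * a = 0 → r = 0) (n : ℕ) :
    Function.Injective (pOf a n) := by
  rw [injective_iff_map_eq_zero]
  intro x hx
  obtain ⟨j, hj, h⟩ := Module.DirectLimit.of.zero_exact hx
  exact psi_inj a h1 _ _ _ (h.trans (map_zero _).symm)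

theorem pOf_surj {R : Type*} [Ring R] (a : R) (z : pruefer R a) : ∃ n x, pOf a n x = z :=
  Module.DirectLimit.exists_of z

/-- the filtration -/
noncomputable def pV {R : Type*} [Ring R] (a : R) : ℕ → Submodule R (pruefer R a)
  | 0 => ⊥
  | n + 1 => LinearMap.range (pOf a n)

theorem pV_mono {R : Type*} [Ring R] (a : R) : Monotone (pV a) := by
  apply monotone_nat_of_le_succ
  rintro (_ | n)
  · exact bot_le
  · rintro _ ⟨x, rfl⟩
    exact ⟨psi a (n + 1) (n + 1 + 1) (Nat.le_succ _) x, pOf_psi _ _ _ _ _⟩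

theorem pV_map {R : Type*} [Ring R] (a : R) (i n : ℕ) (h : i ≤ n + 1) :
    (LinearMap.range (psi a i (n + 1) h)).map (pOf a n) = pV a i := by
  rw [← LinearMap.range_comp]
  cases i with
  | zero =>
    refine LinearMap.range_eq_bot.mpr ?_
    refine LinearMap.ext fun x => ?_
    have hx : x = 0 := by
      obtain ⟨r, rfl⟩ := Submodule.Quotient.mk_surjective _ x
      rw [Submodule.Quotient.mk_eq_zero, Submodule.mem_span_singleton]
      exact ⟨r, by simp⟩
    rw [hx, map_zero, map_zero]
  | succ k =>
    change _ = LinearMap.range (pOf a k)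
    congr 1
    exact LinearMap.ext fun x => pOf_psi a k n h x

theorem pV_class {R : Type*} [Ring R] (a : R)
    (hu : ∀ n : ℕ, ∀ N : Submodule R (R ⧸ Submodule.span R {a ^ (n + 1)}),
          ∃ (i : ℕ) (h : i ≤ n + 1), N = LinearMap.range (psi a i (n + 1) h))
    (N : Submodule R (pruefer R a)) : N = ⊤ ∨ ∃ k, N = pV a k := by
  have key : ∀ n, ∃ i, N ⊓ pV a (n + 1) = pV a i := by
    intro n
    obtain ⟨i, hi, h⟩ := hu n (N.comap (pOf a n))
    refine ⟨i, ?_⟩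
    rw [← pV_map a i n hi, ← h, Submodule.map_comap_eq, inf_comm]
    rfl
  by_cases hall : ∀ n, pV a (n + 1) ≤ N
  · left
    rw [eq_top_iff]
    intro z _
    obtain ⟨n, x, rfl⟩ := pOf_surj a z
    exact hall n ⟨x, rfl⟩
  · right
    push Not at hall
    obtain ⟨n, hn⟩ := hall
    obtain ⟨i, hi⟩ := key n
    refine ⟨i, ?_⟩
    rw [← hi, eq_comm, inf_eq_left]
    intro z hz
    obtain ⟨m, x, rfl⟩ := pOf_surj a z
    obtain ⟨j, hj⟩ := key m
    have hzj : pOf a m x ∈ pV a j := hj ▸ ⟨hz, ⟨x, rfl⟩⟩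
    rcases le_total j (n + 1) with h | h
    · exact pV_mono a h hzj
    · exact absurd ((pV_mono a h).trans (hj ▸ inf_le_left)) hn

/-- Assume that for every `n ≥ 1` the left `R`-module `M_n = R/R·a^n` is uniserial
of length `n` (its submodules are exactly the `n+1` strictly increasing images of the maps
`ψ_{i,n}`, `0 ≤ i ≤ n`). Then the `a`-Prüfer module `U_{R,a}` is a uniserial and artinian left
`R`-module, and it is not noetherian. -/
theorem stmt_5 {R : Type*} [Ring R] [Nontrivial R] (a : R)
    (h1 : ∀ r : R, r * a = 0 → r = 0)
    (h2 : Submodule.span R {a} ≠ (⊤ : Submodule R R))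
    (huni : ∀ n : ℕ, 1 ≤ n →
      (∀ N : Submodule R (R ⧸ Submodule.span R {a ^ n}),
          ∃ (i : ℕ) (h : i ≤ n), N = LinearMap.range (psi a i n h)) ∧
      ∀ (i j : ℕ) (hi : i ≤ n) (hj : j ≤ n), i < j →
        LinearMap.range (psi a i n hi) < LinearMap.range (psi a j n hj)) :
    (∀ N N' : Submodule R (pruefer R a), N ≤ N' ∨ N' ≤ N) ∧
    IsArtinian R (pruefer R a) ∧ ¬IsNoetherian R (pruefer R a) := by
  have hc := pV_class a (fun n => (huni (n + 1) (Nat.succ_le_succ (Nat.zero_le n))).1)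
  refine ⟨?_, ?_, ?_⟩
  · intro N N'
    rcases hc N with rfl | ⟨k, rfl⟩
    · exact Or.inr le_top
    · rcases hc N' with rfl | ⟨l, rfl⟩
      · exact Or.inl le_top
      · exact (le_total k l).imp (fun h => pV_mono a h) (fun h => pV_mono a h)
  · have hacc : ∀ k, Acc (· < ·) (pV a k) := by
      intro k
      induction k using Nat.strong_induction_on with
      | _ k ih =>
        refine ⟨_, fun N hN => ?_⟩
        rcases hc N with rfl | ⟨l, rfl⟩
        · exact absurd hN not_top_lt
        · refine ih l ?_
          by_contra hl
          exact absurd (pV_mono a (not_lt.mp hl)) (not_le_of_gt hN)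
    refine ⟨⟨fun N => ?_⟩⟩
    rcases hc N with rfl | ⟨l, rfl⟩
    · refine ⟨_, fun N hN => ?_⟩
      rcases hc N with rfl | ⟨l, rfl⟩
      · exact absurd hN (lt_irrefl _)
      · exact hacc l
    · exact hacc l
  · intro hN
    obtain ⟨n, hn⟩ := monotone_stabilizes_iff_noetherian.mpr hN ⟨pV a, pV_mono a⟩
    have e1 : pV a (n + 1) = pV a (n + 1 + 1) :=
      (hn (n + 1) (by omega)).symm.trans (hn (n + 1 + 1) (by omega))
    have hlt := (huni (n + 1 + 1) (by omega)).2 (n + 1) (n + 1 + 1) (by omega) le_rfl (by omega)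
    refine absurd hlt (not_lt_of_ge ?_)
    intro x _
    have hx : pOf a (n + 1) x ∈ pV a (n + 1) := e1 ▸ ⟨x, rfl⟩
    obtain ⟨y, hy⟩ := hx
    refine ⟨y, pOf_inj a h1 (n + 1) ?_⟩
    rw [← hy]
    exact pOf_psi _ _ _ _ _
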